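/- arXiv:2412.08379 — 4 statements merged into one kernel-verified Lean document; each statement's English description precedes it below -/
import Mathlib

section
/- Let 2 ≤ n ≤ N, θ_n ∈ [0,1/2], and α ∈ [0,1). Then for every 1 ≤ k ≤ n−1 one has b_{n−k}^{(α)} ≤ (1/4) a_{n−k}^{(α)}, and if moreover α > 0 then b_{n−k}^{(α)} > 0. -/
open Real MeasureTheory

/-- Graded mesh point `t_j = T (j/N)^r`. -/
noncomputable def gridT (T r : ℝ) (N j : ℕ) : ℝ := T * ((j : ℝ) / (N : ℝ)) ^ r

/-- Step size `τ_j = t_j - t_{j-1}`. -/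
noncomputable def gridTau (T r : ℝ) (N j : ℕ) : ℝ := gridT T r N j - gridT T r N (j - 1)

/-- Step-size ratio `ρ_j = τ_j / τ_{j+1}`. -/
noncomputable def gridRho (T r : ℝ) (N j : ℕ) : ℝ := gridTau T r N j / gridTau T r N (j + 1)

/-- Offset point `t_{n-θ} = θ t_{n-1} + (1-θ) t_n`. -/
noncomputable def tTheta (T r : ℝ) (N n : ℕ) (θ : ℝ) : ℝ :=
  θ * gridT T r N (n - 1) + (1 - θ) * gridT T r N n

/-- Coefficient `a_{n-k}^{(α)}`, parametrized by `k`. -/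
noncomputable def coefA (T r : ℝ) (N n : ℕ) (θ α : ℝ) (k : ℕ) : ℝ :=
  (1 / (gridTau T r N k * Real.Gamma (1 - α))) *
    ∫ s in (gridT T r N (k - 1))..(min (gridT T r N k) (tTheta T r N n θ)),
      (tTheta T r N n θ - s) ^ (-α)

/-- Coefficient `b_{n-k}^{(α)}`, parametrized by `k`. -/
noncomputable def coefB (T r : ℝ) (N n : ℕ) (θ α : ℝ) (k : ℕ) : ℝ :=
  (2 / (gridTau T r N k * (gridTau T r N k + gridTau T r N (k + 1)) * Real.Gamma (1 - α))) *
    ∫ s in (gridT T r N (k - 1))..(gridT T r N k),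
      (s - (gridT T r N (k - 1) + gridT T r N k) / 2) * (tTheta T r N n θ - s) ^ (-α)

/-- Coefficient `I_{n-k}^{(α)}`, parametrized by `k`. -/
noncomputable def coefI (T r : ℝ) (N n : ℕ) (θ α : ℝ) (k : ℕ) : ℝ :=
  (α / (Real.Gamma (1 - α) * gridTau T r N k)) *
    ∫ s in (gridT T r N (k - 1))..(gridT T r N k),
      (gridT T r N k - s) * (tTheta T r N n θ - s) ^ (-α - 1)

/-- Coefficient `J_{n-k}^{(α)}`, parametrized by `k`. -/
noncomputable def coefJ (T r : ℝ) (N n : ℕ) (θ α : ℝ) (k : ℕ) : ℝ :=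
  (α / (Real.Gamma (1 - α) * gridTau T r N k)) *
    ∫ s in (gridT T r N (k - 1))..(gridT T r N k),
      (s - gridT T r N (k - 1)) * (tTheta T r N n θ - s) ^ (-α - 1)

/-- Coefficient `c_{n-k,n}^{(α)}`, parametrized by `k` (`1 ≤ k ≤ n`). -/
noncomputable def coefC (T r : ℝ) (N n : ℕ) (θ α : ℝ) (k : ℕ) : ℝ :=
  if n = 1 then coefA T r N n θ α n
  else if k = n then coefA T r N n θ α n + gridRho T r N (n - 1) * coefB T r N n θ α (n - 1)
  else if k = 1 then coefA T r N n θ α 1 - coefB T r N n θ α 1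
  else coefA T r N n θ α k + gridRho T r N (k - 1) * coefB T r N n θ α (k - 1)
         - coefB T r N n θ α k

lemma gridT_lt {T r : ℝ} {N i j : ℕ} (hT : 0 < T) (hr : 1 ≤ r) (hN : 1 ≤ N) (hij : i < j) :
    gridT T r N i < gridT T r N j := by
  have hN' : (0 : ℝ) < N := by exact_mod_cast hN
  have hij' : (i : ℝ) < j := by exact_mod_cast hij
  unfold gridT
  gcongr

lemma gridT_le {T r : ℝ} {N i j : ℕ} (hT : 0 < T) (hr : 1 ≤ r) (hN : 1 ≤ N) (hij : i ≤ j) :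
    gridT T r N i ≤ gridT T r N j := by
  rcases hij.eq_or_lt with rfl | h
  · exact le_rfl
  · exact (gridT_lt hT hr hN h).le

lemma gridT_midpoint_convex {T r : ℝ} (N j : ℕ) (hT : 0 < T) (hr : 1 ≤ r) :
    2 * gridT T r N (j + 1) ≤ gridT T r N j + gridT T r N (j + 2) := by
  have hx : (0 : ℝ) ≤ (j : ℝ) / N := by positivity
  have hy : (0 : ℝ) ≤ ((j + 2 : ℕ) : ℝ) / N := by positivity
  have h := (convexOn_rpow hr).2 hx hy (by norm_num : (0 : ℝ) ≤ 1 / 2)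
    (by norm_num : (0 : ℝ) ≤ 1 / 2) (by norm_num)
  simp only [smul_eq_mul] at h
  have e : 1 / 2 * ((j : ℝ) / N) + 1 / 2 * (((j + 2 : ℕ) : ℝ) / N) = ((j + 1 : ℕ) : ℝ) / N := by
    push_cast
    ring
  rw [e] at h
  unfold gridT
  nlinarith

/-- The function `s ↦ (d - s) (c - s)^(-α)` is antitone on `s < d` when `d ≤ c`, `α ≤ 1`. -/
lemma sub_mul_sub_rpow_neg_le {c d α s s' : ℝ} (hα1 : α ≤ 1) (hdc : d ≤ c)
    (hs : s ≤ s') (hs' : s' < d) :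
    (d - s') * (c - s') ^ (-α) ≤ (d - s) * (c - s) ^ (-α) := by
  have h1 : 0 < c - s' := by linarith
  have h2 : 0 < c - s := by linarith
  have h3 : 0 < d - s := by linarith
  have hq : (c - s') / (c - s) ≤ ((c - s') / (c - s)) ^ α :=
    Real.self_le_rpow_of_le_one (by positivity) (by rw [div_le_one h2]; linarith) hα1
  have hd : (d - s') / (d - s) ≤ (c - s') / (c - s) := by
    rw [div_le_div_iff₀ h3 h2]
    nlinarith [mul_nonneg (sub_nonneg.2 hs) (sub_nonneg.2 hdc)]
  have h := hd.trans hq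
  rw [Real.div_rpow h1.le h2.le, div_le_div_iff₀ h3 (by positivity)] at h
  rw [Real.rpow_neg h1.le, Real.rpow_neg h2.le, ← div_eq_mul_inv, ← div_eq_mul_inv,
    div_le_div_iff₀ (by positivity) (by positivity)]
  linarith

lemma continuousOn_sub_rpow_neg {p q c α : ℝ} (hqc : q < c) :
    ContinuousOn (fun s : ℝ => (c - s) ^ (-α)) (Set.Icc p q) := by
  refine ContinuousOn.rpow_const (by fun_prop) fun s hs => Or.inl ?_
  have := hs.2
  linarith

lemma integral_sub_midpoint (p q C : ℝ) : ∫ s in p..q, (s - (p + q) / 2) * C = 0 := by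
  rw [intervalIntegral.integral_mul_const, intervalIntegral.integral_sub (by simp) (by simp)]
  simp only [integral_id, intervalIntegral.integral_const, smul_eq_mul]
  ring

/-- Tangent-type bound for the kernel against `s - midpoint - (q - p)/4`. -/
lemma sub_midpoint_mul_rpow_neg_le {p q c α s : ℝ} (hpq : p < q) (hα1 : α ≤ 1)
    (hc : (p + q) / 2 + (q - p) ≤ c) (hs : s ∈ Set.Icc p q) :
    (s - (p + q) / 2) * (c - s) ^ (-α) - (q - p) / 4 * (c - s) ^ (-α) ≤
      (s - (p + q) / 2) *
        (3 / 4 * (c - ((p + q) / 2 + (q - p) / 4)) ^ (-α)) := by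
  obtain ⟨hs1, hs2⟩ := hs
  set d := (p + q) / 2 + (q - p) with hd
  set w := (p + q) / 2 + (q - p) / 4 with hw
  have hsd : 0 < d - s := by linarith
  have hG : 0 ≤ (d - w) * (c - w) ^ (-α) :=
    mul_nonneg (by linarith) (Real.rpow_nonneg (by linarith) _)
  have hdw : d - w = 3 / 4 * (q - p) := by rw [hd, hw]; ring
  have key : (s - w) * ((d - s) * (c - s) ^ (-α)) ≤ (s - w) * ((d - w) * (c - w) ^ (-α)) := by
    rcases le_total s w with h | h
    · exact mul_le_mul_of_nonpos_left
        (sub_mul_sub_rpow_neg_le hα1 hc h (by linarith)) (by linarith)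
    · exact mul_le_mul_of_nonneg_left
        (sub_mul_sub_rpow_neg_le hα1 hc h (by linarith)) (by linarith)
  have quad : (s - w) * (q - p) ≤ (s - (p + q) / 2) * (d - s) := by
    rw [hd, hw]
    nlinarith [mul_nonneg (sub_nonneg.2 hs1) (sub_nonneg.2 hs2)]
  have hR : 0 ≤ 3 / 4 * (c - w) ^ (-α) :=
    mul_nonneg (by norm_num) (Real.rpow_nonneg (by linarith) _)
  have h2 := mul_le_mul_of_nonneg_right quad hR
  rw [hdw] at key
  refine le_of_mul_le_mul_right ?_ hsd
  have e : ((s - (p + q) / 2) * (c - s) ^ (-α) - (q - p) / 4 * (c - s) ^ (-α)) * (d - s)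
      = (s - w) * ((d - s) * (c - s) ^ (-α)) := by
    rw [hw]; ring
  rw [e]
  linarith

lemma integral_sub_midpoint_mul_rpow_neg_le {p q c α : ℝ} (hpq : p < q)
    (hα1 : α ≤ 1) (hc : (p + q) / 2 + (q - p) ≤ c) :
    ∫ s in p..q, (s - (p + q) / 2) * (c - s) ^ (-α) ≤
      (q - p) / 4 * ∫ s in p..q, (c - s) ^ (-α) := by
  have hf : ContinuousOn (fun s : ℝ => (c - s) ^ (-α)) (Set.Icc p q) :=
    continuousOn_sub_rpow_neg (by linarith)
  have i1 : IntervalIntegrable (fun s : ℝ => (s - (p + q) / 2) * (c - s) ^ (-α)) volume p q :=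
    ContinuousOn.intervalIntegrable_of_Icc hpq.le (ContinuousOn.mul (by fun_prop) hf)
  have i2 : IntervalIntegrable (fun s : ℝ => (q - p) / 4 * (c - s) ^ (-α)) volume p q :=
    ContinuousOn.intervalIntegrable_of_Icc hpq.le (ContinuousOn.mul (by fun_prop) hf)
  have h := intervalIntegral.integral_mono_on hpq.le (i1.sub i2)
    (Continuous.intervalIntegrable (by fun_prop) p q)
    (fun s hs => sub_midpoint_mul_rpow_neg_le hpq hα1 hc hs)
  rw [integral_sub_midpoint, intervalIntegral.integral_sub i1 i2,
    intervalIntegral.integral_const_mul] at h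
  linarith

lemma integral_sub_midpoint_mul_rpow_neg_pos {p q c α : ℝ} (hpq : p < q) (hqc : q < c)
    (hα : 0 < α) : 0 < ∫ s in p..q, (s - (p + q) / 2) * (c - s) ^ (-α) := by
  rw [← integral_sub_midpoint p q ((c - (p + q) / 2) ^ (-α))]
  refine intervalIntegral.integral_lt_integral_of_continuousOn_of_le_of_exists_lt hpq
    (by fun_prop) (ContinuousOn.mul (by fun_prop) (continuousOn_sub_rpow_neg hqc)) ?_
    ⟨q, ⟨hpq.le, le_rfl⟩, ?_⟩
  · intro s hs
    rcases le_total s ((p + q) / 2) with h | h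
    · exact mul_le_mul_of_nonpos_left
        (Real.rpow_le_rpow_of_nonpos (by linarith) (by linarith) (by linarith)) (by linarith)
    · exact mul_le_mul_of_nonneg_left
        (Real.rpow_le_rpow_of_nonpos (by linarith [hs.2]) (by linarith) (by linarith))
        (by linarith)
  · exact mul_lt_mul_of_pos_left
      (Real.rpow_lt_rpow_of_neg (by linarith) (by linarith) (by linarith)) (by linarith)

lemma integral_sub_midpoint_mul_rpow_neg_nonneg {p q c α : ℝ} (hpq : p < q) (hqc : q < c)
    (hα : 0 ≤ α) : 0 ≤ ∫ s in p..q, (s - (p + q) / 2) * (c - s) ^ (-α) := by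
  rcases hα.eq_or_lt with rfl | h
  · simpa using (integral_sub_midpoint p q 1).ge
  · exact (integral_sub_midpoint_mul_rpow_neg_pos hpq hqc h).le

/-- For `2 ≤ n ≤ N`, `θ ∈ [0,1/2]`, `α ∈ [0,1)` and `1 ≤ k ≤ n-1`, one has
`b_{n-k}^{(α)} ≤ (1/4) a_{n-k}^{(α)}`, and `b_{n-k}^{(α)} > 0` when `α > 0`. -/
theorem coefB_le_quarter_coefA (T r : ℝ) (N n : ℕ) (θ α : ℝ)
    (hT : 0 < T) (hr : 1 ≤ r) (hN : 1 ≤ N) (hn2 : 2 ≤ n) (hnN : n ≤ N)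
    (hθ0 : 0 ≤ θ) (hθ : θ ≤ 1 / 2) (hα0 : 0 ≤ α) (hα1 : α < 1) :
    ∀ k : ℕ, 1 ≤ k → k ≤ n - 1 →
      coefB T r N n θ α k ≤ (1 / 4) * coefA T r N n θ α k ∧
      (0 < α → 0 < coefB T r N n θ α k) := by
  intro k hk1 hkn
  obtain ⟨j, rfl⟩ : ∃ j, k = j + 1 := ⟨k - 1, by omega⟩
  have hpq : gridT T r N j < gridT T r N (j + 1) := gridT_lt hT hr hN (by omega)
  have hconv := gridT_midpoint_convex N j hT hr
  have hm1 : gridT T r N (j + 1) ≤ gridT T r N (n - 1) := gridT_le hT hr hN hkn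
  have hm2 : gridT T r N (j + 2) ≤ gridT T r N n := gridT_le hT hr hN (by omega)
  have hm3 : gridT T r N (n - 1) ≤ gridT T r N n := gridT_le hT hr hN (by omega)
  have hc : (gridT T r N (j + 1) + gridT T r N (j + 2)) / 2 ≤ tTheta T r N n θ := by
    unfold tTheta
    nlinarith [mul_nonneg (sub_nonneg.2 hθ) (sub_nonneg.2 hm3)]
  have hG : 0 < Real.Gamma (1 - α) := Real.Gamma_pos_of_pos (by linarith)
  have hqc : gridT T r N (j + 1) < tTheta T r N n θ := by linarith
  unfold coefA coefB gridTau
  simp only [Nat.add_sub_cancel, add_assoc, Nat.reduceAdd]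
  rw [min_eq_left hqc.le]
  set p := gridT T r N j
  set q := gridT T r N (j + 1)
  set q' := gridT T r N (j + 2)
  set c := tTheta T r N n θ
  set G := Real.Gamma (1 - α)
  have hle := integral_sub_midpoint_mul_rpow_neg_le hpq hα1.le (c := c) (by linarith)
  have hnn := integral_sub_midpoint_mul_rpow_neg_nonneg hpq hqc hα0
  have hh : 0 < q - p := by linarith
  have hh' : 0 < q - p + (q' - q) := by linarith
  refine ⟨?_, fun hα => mul_pos (by positivity)
    (integral_sub_midpoint_mul_rpow_neg_pos hpq hqc hα)⟩
  calc 2 / ((q - p) * (q - p + (q' - q)) * G) * ∫ s in p..q, (s - (p + q) / 2) * (c - s) ^ (-α)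
      ≤ 1 / ((q - p) * (q - p) * G) * ∫ s in p..q, (s - (p + q) / 2) * (c - s) ^ (-α) := by
        refine mul_le_mul_of_nonneg_right ?_ hnn
        rw [div_le_div_iff₀ (by positivity) (by positivity)]
        nlinarith [mul_nonneg (mul_pos hh hG).le (by linarith : 0 ≤ (q' - q) - (q - p))]
    _ ≤ 1 / ((q - p) * (q - p) * G) * ((q - p) / 4 * ∫ s in p..q, (c - s) ^ (-α)) :=
        mul_le_mul_of_nonneg_left hle (by positivity)
    _ = 1 / 4 * (1 / ((q - p) * G) * ∫ s in p..q, (c - s) ^ (-α)) := by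
        field_simp
end

section
/- Let 2 ≤ n ≤ N, θ_n ∈ [0,1/2], and α ∈ (0,1). Then for every 1 ≤ k ≤ n−1 the integration-by-parts identity b_{n−k}^{(α)} = (α/(Γ(1−α) τ_k (τ_k + τ_{k+1}))) ∫_{t_{k−1}}^{t_k} (t_k − s)(s − t_{k−1}) (t_{n−θ_n} − s)^{−α−1} ds holds. -/
open Real MeasureTheory

theorem gridT_strictMono {T r : ℝ} {N : ℕ} (hT : 0 < T) (hr : 0 < r) (hN : 0 < N) :
    StrictMono (gridT T r N) := by
  intro i j hij
  have hN' : (0 : ℝ) < N := by exact_mod_cast hN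
  have hij' : (i : ℝ) < j := by exact_mod_cast hij
  unfold gridT
  gcongr

theorem gridT_lt_tTheta {T r θ : ℝ} {N n k : ℕ} (hT : 0 < T) (hr : 0 < r) (hN : 0 < N)
    (hn : 1 ≤ n) (hθ : θ < 1) (hk : k ≤ n - 1) : gridT T r N k < tTheta T r N n θ := by
  have hmono := gridT_strictMono hT hr hN
  have hle : gridT T r N k ≤ gridT T r N (n - 1) := hmono.monotone hk
  have hlt : gridT T r N (n - 1) < gridT T r N n := hmono (by omega)
  unfold tTheta
  nlinarith [mul_pos (sub_pos.2 hθ) (sub_pos.2 hlt)]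

theorem two_mul_integral_sub_midpoint_mul_rpow {a b c : ℝ} (α : ℝ) (ha : a < c) (hb : b < c) :
    2 * ∫ s in a..b, (s - (a + b) / 2) * (c - s) ^ (-α) =
      α * ∫ s in a..b, (b - s) * (s - a) * (c - s) ^ (-α - 1) := by
  have hpos : ∀ s ∈ Set.uIcc a b, 0 < c - s := fun s hs ↦
    sub_pos.2 (hs.2.trans_lt (max_lt ha hb))
  have hcont : ∀ p : ℝ, ContinuousOn (fun s ↦ (c - s) ^ p) (Set.uIcc a b) := fun p ↦
    ContinuousOn.rpow_const (by fun_prop) fun s hs ↦ Or.inl (hpos s hs).ne'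
  have hint₁ : IntervalIntegrable (fun s ↦ 2 * ((s - (a + b) / 2) * (c - s) ^ (-α)))
      volume a b := by
    have := hcont (-α)
    exact ContinuousOn.intervalIntegrable (by fun_prop)
  have hint₂ : IntervalIntegrable (fun s ↦ α * ((b - s) * (s - a) * (c - s) ^ (-α - 1)))
      volume a b := by
    have := hcont (-α - 1)
    exact ContinuousOn.intervalIntegrable (by fun_prop)
  have hderiv : ∀ s ∈ Set.uIcc a b,
      HasDerivAt (fun s ↦ (s - b) * (s - a) * (c - s) ^ (-α))
        (2 * ((s - (a + b) / 2) * (c - s) ^ (-α)) -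
          α * ((b - s) * (s - a) * (c - s) ^ (-α - 1))) s := by
    intro s hs
    have hpow := ((hasDerivAt_id s).const_sub c).rpow_const (p := -α) (Or.inl (hpos s hs).ne')
    have hpoly := ((hasDerivAt_id s).sub_const b).mul ((hasDerivAt_id s).sub_const a)
    refine (hpoly.mul hpow).congr_deriv ?_
    simp only [id, Pi.mul_apply]
    ring
  have hFTC := intervalIntegral.integral_eq_sub_of_hasDerivAt hderiv (hint₁.sub hint₂)
  rw [intervalIntegral.integral_sub hint₁ hint₂, intervalIntegral.integral_const_mul,
    intervalIntegral.integral_const_mul] at hFTC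
  simp only [sub_self, zero_mul, mul_zero] at hFTC
  exact sub_eq_zero.1 hFTC

/-- Integration-by-parts identity for `b_{n-k}^{(α)}`. -/
theorem coefB_eq_parts (T r : ℝ) (N n : ℕ) (θ α : ℝ)
    (hT : 0 < T) (hr : 1 ≤ r) (hN : 1 ≤ N) (hn2 : 2 ≤ n) (hnN : n ≤ N)
    (hθ0 : 0 ≤ θ) (hθ : θ ≤ 1 / 2) (hα0 : 0 < α) (hα1 : α < 1) :
    ∀ k : ℕ, 1 ≤ k → k ≤ n - 1 →
      coefB T r N n θ α k =
        (α / (Real.Gamma (1 - α) * gridTau T r N k * (gridTau T r N k + gridTau T r N (k + 1)))) *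
          ∫ s in (gridT T r N (k - 1))..(gridT T r N k),
            (gridT T r N k - s) * (s - gridT T r N (k - 1)) *
              (tTheta T r N n θ - s) ^ (-α - 1) := by
  intro k hk1 hk
  have hlt : ∀ j ≤ n - 1, gridT T r N j < tTheta T r N n θ := fun j hj ↦
    gridT_lt_tTheta hT (by linarith) (by omega) (by omega) (by linarith) hj
  have hparts := two_mul_integral_sub_midpoint_mul_rpow α (hlt (k - 1) (by omega)) (hlt k hk)
  unfold coefB
  rw [div_mul_eq_mul_div, div_mul_eq_mul_div, hparts]
  congr 1
  ring
end

section
/- Let 2 ≤ n ≤ N, θ_n ∈ [0,1/2], and α ∈ (0,1). Then a_0^{(α)} − a_1^{(α)} = ((α − θ_n)/(1 − α)) · (t_{n−θ_n} − t_{n−1})^{−α}/Γ(1−α) + J_1^{(α)}, where a_0^{(α)} = (t_{n−θ_n} − t_{n−1})^{1−α}/(Γ(2−α) τ_n). -/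
open Real MeasureTheory

theorem gridT_lt_gridT {T r : ℝ} {N j k : ℕ} (hT : 0 < T) (hr : 0 < r) (hN : 0 < N)
    (hjk : j < k) : gridT T r N j < gridT T r N k := by
  have hN' : (0 : ℝ) < N := by exact_mod_cast hN
  have hjk' : (j : ℝ) < k := by exact_mod_cast hjk
  exact mul_lt_mul_of_pos_left
    (rpow_lt_rpow (by positivity) (div_lt_div_of_pos_right hjk' hN') hr) hT

theorem integral_sub_left_rpow_neg {α b c : ℝ} (hα : α < 1) :
    ∫ s in b..c, (c - s) ^ (-α) = (c - b) ^ (1 - α) / (1 - α) := by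
  rw [intervalIntegral.integral_comp_sub_left (fun x => x ^ (-α)) c,
    integral_rpow (Or.inl (by linarith)), sub_self, show -α + 1 = 1 - α by ring,
    zero_rpow (by linarith), sub_zero]

/-- Integration by parts against the kernel `(c - s) ^ (-α)` away from its singularity. -/
theorem mul_integral_sub_mul_rpow {α a b c : ℝ} (hab : a ≤ b) (hbc : b < c) :
    α * ∫ s in a..b, (s - a) * (c - s) ^ (-α - 1) =
      (b - a) * (c - b) ^ (-α) - ∫ s in a..b, (c - s) ^ (-α) := by
  have hpos : ∀ x ∈ Set.uIcc a b, c - x ≠ 0 := by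
    intro x hx
    rw [Set.uIcc_of_le hab] at hx
    exact (sub_pos.2 (hx.2.trans_lt hbc)).ne'
  have hv : ∀ x ∈ Set.uIcc a b,
      HasDerivAt (fun s => (c - s) ^ (-α)) (α * (c - x) ^ (-α - 1)) x := by
    intro x hx
    have h := ((hasDerivAt_id' x).const_sub c).rpow_const (p := -α) (Or.inl (hpos x hx))
    convert h using 1
    ring
  have hcont : ContinuousOn (fun x => α * (c - x) ^ (-α - 1)) (Set.uIcc a b) :=
    continuousOn_const.mul
      ((continuousOn_const.sub continuousOn_id).rpow_const fun x hx => Or.inl (hpos x hx))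
  have h := intervalIntegral.integral_mul_deriv_eq_deriv_mul
    (u := fun s => s - a) (u' := fun _ => 1)
    (fun x _ => (hasDerivAt_id x).sub_const a) hv intervalIntegrable_const
    hcont.intervalIntegrable
  simp only [sub_self, zero_mul, sub_zero, one_mul] at h
  rw [← h, ← intervalIntegral.integral_const_mul]
  congr 1
  ext s
  ring

/-- `a_0^{(α)} - a_1^{(α)} = ((α-θ)/(1-α)) (t_{n-θ}-t_{n-1})^{-α}/Γ(1-α) + J_1^{(α)}`,
where `a_0^{(α)} = (t_{n-θ}-t_{n-1})^{1-α}/(Γ(2-α) τ_n)`. -/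
theorem coefA_zero_sub_one (T r : ℝ) (N n : ℕ) (θ α : ℝ)
    (hT : 0 < T) (hr : 1 ≤ r) (hN : 1 ≤ N) (hn2 : 2 ≤ n) (hnN : n ≤ N)
    (hθ0 : 0 ≤ θ) (hθ : θ ≤ 1 / 2) (hα0 : 0 < α) (hα1 : α < 1) :
    coefA T r N n θ α n - coefA T r N n θ α (n - 1) =
      ((α - θ) / (1 - α)) * ((tTheta T r N n θ - gridT T r N (n - 1)) ^ (-α)
        / Real.Gamma (1 - α)) + coefJ T r N n θ α (n - 1) ∧
    coefA T r N n θ α n =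
      (tTheta T r N n θ - gridT T r N (n - 1)) ^ (1 - α)
        / (Real.Gamma (2 - α) * gridTau T r N n) := by
  have hr0 : 0 < r := by linarith
  have hα : 0 < 1 - α := by linarith
  have hΓ : 0 < Real.Gamma (1 - α) := Real.Gamma_pos_of_pos hα
  have hΓ2 : Real.Gamma (2 - α) = (1 - α) * Real.Gamma (1 - α) := by
    rw [← Real.Gamma_add_one hα.ne']
    ring_nf
  have hab : gridT T r N (n - 1 - 1) < gridT T r N (n - 1) :=
    gridT_lt_gridT hT hr0 hN (by omega)
  have hbd : gridT T r N (n - 1) < gridT T r N n := gridT_lt_gridT hT hr0 hN (by omega)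
  have hc : tTheta T r N n θ - gridT T r N (n - 1) = (1 - θ) * gridTau T r N n := by
    simp only [tTheta, gridTau]
    ring
  have hτ : 0 < gridTau T r N n := sub_pos.2 hbd
  have hτ' : 0 < gridTau T r N (n - 1) := sub_pos.2 hab
  have hcpos : 0 < tTheta T r N n θ - gridT T r N (n - 1) := by
    rw [hc]
    exact mul_pos (by linarith) hτ
  have hcd : tTheta T r N n θ ≤ gridT T r N n := by
    simp only [tTheta]
    nlinarith
  have h0 : coefA T r N n θ α n = (tTheta T r N n θ - gridT T r N (n - 1)) ^ (1 - α)
      / (Real.Gamma (2 - α) * gridTau T r N n) := by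
    rw [coefA, min_eq_right hcd, integral_sub_left_rpow_neg hα1, hΓ2]
    field_simp
  have hJ : coefJ T r N n θ α (n - 1) =
      (tTheta T r N n θ - gridT T r N (n - 1)) ^ (-α) / Real.Gamma (1 - α)
        - coefA T r N n θ α (n - 1) := by
    have h := mul_integral_sub_mul_rpow (α := α) hab.le (sub_pos.1 hcpos)
    rw [coefA, coefJ, min_eq_left (sub_pos.1 hcpos).le, div_mul_eq_mul_div, h,
      ← gridTau]
    field_simp
  refine ⟨?_, h0⟩
  have hpow : (tTheta T r N n θ - gridT T r N (n - 1)) ^ (1 - α) =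
      (1 - θ) * gridTau T r N n * (tTheta T r N n θ - gridT T r N (n - 1)) ^ (-α) := by
    rw [sub_eq_add_neg 1 α, rpow_add hcpos, rpow_one, ← hc]
  rw [hJ, h0, hpow, hΓ2]
  field_simp
  ring
end

section
/- Let 2 ≤ n ≤ N, θ_n ∈ [0,1/2], and α ∈ (0,1) with α ≥ θ_n. If n = 2 then a_0^{(α)} − a_1^{(α)} ≥ I_1^{(α)}; if n ≥ 3 then a_0^{(α)} − a_1^{(α)} ≥ ρ_{n−2} b_2^{(α)} + (1/2) I_1^{(α)}. -/
open Real MeasureTheory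

theorem rpow_neg_tangent_le {u y α : ℝ} (hu : 0 < u) (hy : 0 < y) (hα : 0 ≤ α) :
    y ^ (-α) - α * y ^ (-α - 1) * (u - y) ≤ u ^ (-α) := by
  have hq : 0 < u / y := div_pos hu hy
  have hlog : Real.log (u / y) ≤ u / y - 1 := Real.log_le_sub_one_of_pos hq
  have hexp : 1 - α * (u / y - 1) ≤ (u / y) ^ (-α) := by
    rw [Real.rpow_def_of_pos hq]
    have := Real.add_one_le_exp (Real.log (u / y) * (-α))
    nlinarith [mul_le_mul_of_nonneg_left hlog hα]
  have hyp : 0 < y ^ (-α) := Real.rpow_pos_of_pos hy _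
  rw [Real.div_rpow hu.le hy.le, le_div_iff₀ hyp] at hexp
  rw [Real.rpow_sub_one hy.ne']
  refine le_trans (le_of_eq ?_) hexp
  field_simp

theorem rpow_neg_le_chord {x y z α : ℝ} (hx : 0 < x) (hxz : x ≤ z) (hzy : z ≤ y) (hα : 0 ≤ α) :
    (y - x) * z ^ (-α) ≤ (y - z) * x ^ (-α) + (z - x) * y ^ (-α) := by
  have hz := hx.trans_le hxz
  have hxt := mul_le_mul_of_nonneg_left (rpow_neg_tangent_le hx hz hα) (sub_nonneg.2 hzy)
  have hyt := mul_le_mul_of_nonneg_left (rpow_neg_tangent_le (hz.trans_le hzy) hz hα)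
    (sub_nonneg.2 hxz)
  linarith

theorem continuousOn_sub_rpow {p q d : ℝ} (hpq : p ≤ q) (hqd : q < d) (β : ℝ) :
    ContinuousOn (fun s : ℝ => (d - s) ^ β) (Set.uIcc p q) := by
  rw [Set.uIcc_of_le hpq]
  exact ContinuousOn.rpow_const (by fun_prop) fun s hs => Or.inl (by linarith [hs.2])

theorem integral_sub_rpow_neg_le_trapezoid {p q d α : ℝ} (hpq : p < q) (hqd : q < d)
    (hα : 0 ≤ α) :
    ∫ s in p..q, (d - s) ^ (-α) ≤ (q - p) / 2 * ((d - p) ^ (-α) + (d - q) ^ (-α)) := by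
  have hqp : 0 < q - p := sub_pos.2 hpq
  set P := (d - p) ^ (-α)
  set Q := (d - q) ^ (-α)
  have hint : ∫ s in p..q, ((q - s) * P + (s - p) * Q) / (q - p)
      = (q - p) / 2 * (P + Q) := by
    rw [intervalIntegral.integral_eq_sub_of_hasDerivAt
      (f := fun s => (-(q - s) ^ 2 / 2 * P + (s - p) ^ 2 / 2 * Q) / (q - p))]
    · field_simp
      ring
    · intro s _
      have h1 : HasDerivAt (fun s : ℝ => q - s) (-1) s := by
        simpa using (hasDerivAt_id s).const_sub q
      have h2 : HasDerivAt (fun s : ℝ => s - p) 1 s := (hasDerivAt_id s).sub_const p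
      refine (((((h1.pow 2).neg.div_const 2).mul_const P).add
        (((h2.pow 2).div_const 2).mul_const Q)).div_const (q - p)).congr_deriv ?_
      norm_num
    · exact Continuous.intervalIntegrable (by fun_prop) _ _
  rw [← hint]
  refine intervalIntegral.integral_mono_on hpq.le
    (continuousOn_sub_rpow hpq.le hqd _).intervalIntegrable
    (Continuous.intervalIntegrable (by fun_prop) _ _) fun s hs => ?_
  rw [le_div_iff₀ hqp]
  have := rpow_neg_le_chord (x := d - q) (y := d - p) (z := d - s) (sub_pos.2 hqd)
    (by linarith [hs.2]) (by linarith [hs.1]) hα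
  linarith

theorem integral_sub_mul_sub_rpow {p q d : ℝ} (α : ℝ) (hpq : p ≤ q) (hqd : q < d) :
    α * ∫ s in p..q, (q - s) * (d - s) ^ (-α - 1)
      = (∫ s in p..q, (d - s) ^ (-α)) - (q - p) * (d - p) ^ (-α) := by
  have hc := continuousOn_sub_rpow hpq hqd (-α)
  have hc' : ContinuousOn (fun s : ℝ => α * ((q - s) * (d - s) ^ (-α - 1))) (Set.uIcc p q) :=
    continuousOn_const.mul
      (ContinuousOn.mul (by fun_prop) (continuousOn_sub_rpow hpq hqd (-α - 1)))
  have hFTC := intervalIntegral.integral_eq_sub_of_hasDerivAt (a := p) (b := q)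
    (f := fun s => (q - s) * (d - s) ^ (-α))
    (f' := fun s => α * ((q - s) * (d - s) ^ (-α - 1)) - (d - s) ^ (-α)) ?_
    (hc'.sub hc).intervalIntegrable
  · rw [intervalIntegral.integral_sub hc'.intervalIntegrable hc.intervalIntegrable,
      intervalIntegral.integral_const_mul] at hFTC
    simp only [sub_self, zero_mul] at hFTC
    linarith
  · intro s hs
    rw [Set.uIcc_of_le hpq] at hs
    have h1 : HasDerivAt (fun s : ℝ => q - s) (-1) s := by
      simpa using (hasDerivAt_id s).const_sub q
    have h2 : HasDerivAt (fun s : ℝ => d - s) (-1) s := by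
      simpa using (hasDerivAt_id s).const_sub d
    have hds : d - s ≠ 0 := by linarith [hs.2]
    refine (h1.mul (h2.rpow_const (p := -α) (Or.inl hds))).congr_deriv ?_
    ring

theorem integral_sub_midpoint_mul_sub_rpow_le {p q d α : ℝ} (hpq : p ≤ q) (hqd : q < d)
    (hα : 0 ≤ α) :
    ∫ s in p..q, (s - (p + q) / 2) * (d - s) ^ (-α)
      ≤ α * (d - q) ^ (-α - 1) * (q - p) ^ 3 / 4 := by
  have hdq : 0 < d - q := sub_pos.2 hqd
  set F := (d - q) ^ (-α)
  set M := α * (d - q) ^ (-α - 1) with hM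
  have hM0 : 0 ≤ M := mul_nonneg hα (Real.rpow_nonneg hdq.le _)
  have hint : ∫ s in p..q, ((s - (p + q) / 2) * F + (q - p) / 2 * M * (q - s))
      = M * (q - p) ^ 3 / 4 := by
    rw [intervalIntegral.integral_eq_sub_of_hasDerivAt
      (f := fun s => (s - (p + q) / 2) ^ 2 / 2 * F + (q - p) / 2 * M * (-(q - s) ^ 2 / 2))]
    · ring
    · intro s _
      have h1 : HasDerivAt (fun s : ℝ => q - s) (-1) s := by
        simpa using (hasDerivAt_id s).const_sub q
      have h2 : HasDerivAt (fun s : ℝ => s - (p + q) / 2) 1 s :=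
        (hasDerivAt_id s).sub_const _
      refine ((((h2.pow 2).div_const 2).mul_const F).add
        (((h1.pow 2).neg.div_const 2).const_mul ((q - p) / 2 * M))).congr_deriv ?_
      norm_num
    · exact Continuous.intervalIntegrable (by fun_prop) _ _
  rw [← hint]
  refine intervalIntegral.integral_mono_on hpq
    (ContinuousOn.mul (by fun_prop) (continuousOn_sub_rpow hpq hqd _)).intervalIntegrable
    (Continuous.intervalIntegrable (by fun_prop) _ _) fun s hs => ?_
  have hsq : 0 ≤ q - s := sub_nonneg.2 hs.2
  have hlow : F - M * (q - s) ≤ (d - s) ^ (-α) := by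
    have := rpow_neg_tangent_le (u := d - s) (by linarith) hdq hα
    rwa [← hM, show d - s - (d - q) = q - s by ring] at this
  have hupp : (d - s) ^ (-α) ≤ F :=
    Real.rpow_le_rpow_of_nonpos hdq (by linarith) (by linarith)
  have hMs : 0 ≤ M * (q - s) := mul_nonneg hM0 hsq
  have hp := mul_nonneg (sub_nonneg.2 hs.1) hMs
  have hlen := mul_nonneg (sub_nonneg.2 hpq) hMs
  rcases le_total s ((p + q) / 2) with h | h
  · have := mul_le_mul_of_nonneg_left hlow (sub_nonneg.2 h)
    linarith
  · have := mul_le_mul_of_nonneg_left hupp (sub_nonneg.2 h)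
    linarith

theorem integral_sub_rpow_neg_to_self {q d α : ℝ} (hα : α < 1) :
    ∫ s in q..d, (d - s) ^ (-α) = (d - q) ^ (1 - α) / (1 - α) := by
  rw [intervalIntegral.integral_comp_sub_left (fun u : ℝ => u ^ (-α)), sub_self,
    integral_rpow (Or.inl (by linarith)), show -α + 1 = 1 - α by ring,
    Real.zero_rpow (by linarith), sub_zero]

theorem gridT_lt_succ {T r : ℝ} {N : ℕ} (hT : 0 < T) (hr : 1 ≤ r) (hN : 1 ≤ N) (j : ℕ) :
    gridT T r N j < gridT T r N (j + 1) := by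
  have hN' : (0 : ℝ) < N := by exact_mod_cast hN
  unfold gridT
  refine mul_lt_mul_of_pos_left (Real.rpow_lt_rpow (by positivity) ?_ (by linarith)) hT
  gcongr
  exact j.lt_succ_self

theorem gridTau_succ_le {T r : ℝ} {N : ℕ} (hT : 0 < T) (hr : 1 ≤ r) (j : ℕ) :
    gridT T r N (j + 1) - gridT T r N j ≤ gridT T r N (j + 2) - gridT T r N (j + 1) := by
  have hconv := (convexOn_rpow hr).2 (Set.mem_Ici.2 (by positivity : 0 ≤ (j : ℝ) / N))
    (Set.mem_Ici.2 (by positivity : 0 ≤ ((j + 2 : ℕ) : ℝ) / N))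
    (by norm_num : (0 : ℝ) ≤ 1 / 2) (by norm_num : (0 : ℝ) ≤ 1 / 2) (by norm_num)
  have hmid : (1 / 2 : ℝ) • ((j : ℝ) / N) + (1 / 2 : ℝ) • (((j + 2 : ℕ) : ℝ) / N)
      = ((j + 1 : ℕ) : ℝ) / N := by
    push_cast
    simp only [smul_eq_mul]
    ring
  simp only [hmid] at hconv
  simp only [smul_eq_mul] at hconv
  have := mul_le_mul_of_nonneg_left hconv hT.le
  unfold gridT
  linarith

theorem lt_tTheta {T r θ : ℝ} {N : ℕ} (hT : 0 < T) (hr : 1 ≤ r) (hN : 1 ≤ N) (hθ : θ ≤ 1 / 2)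
    (j : ℕ) : gridT T r N j < tTheta T r N (j + 1) θ := by
  have := gridT_lt_succ hT hr hN j
  simp only [tTheta, Nat.add_sub_cancel]
  nlinarith

theorem rpow_neg_le_Gamma_mul_coefA_last {T r θ α : ℝ} {N : ℕ} (hT : 0 < T) (hr : 1 ≤ r)
    (hN : 1 ≤ N) (hθ0 : 0 ≤ θ) (hθ : θ ≤ 1 / 2) (hα1 : α < 1) (hθα : θ ≤ α) (j : ℕ) :
    (tTheta T r N (j + 1) θ - gridT T r N j) ^ (-α)
      ≤ Real.Gamma (1 - α) * coefA T r N (j + 1) θ α (j + 1) := by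
  have hlt := gridT_lt_succ hT hr hN j
  have hG : 0 < Real.Gamma (1 - α) := Real.Gamma_pos_of_pos (by linarith)
  have hd := lt_tTheta hT hr hN hθ j
  have hmin : min (gridT T r N (j + 1)) (tTheta T r N (j + 1) θ) = tTheta T r N (j + 1) θ := by
    refine min_eq_right ?_
    simp only [tTheta, Nat.add_sub_cancel]
    nlinarith
  have hx : tTheta T r N (j + 1) θ - gridT T r N j
      = (1 - θ) * (gridT T r N (j + 1) - gridT T r N j) := by
    simp only [tTheta, Nat.add_sub_cancel]
    ring
  have hx0 := sub_pos.2 hd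
  have hb := sub_pos.2 hlt
  have h1α : 0 < 1 - α := by linarith
  have hxα := Real.rpow_pos_of_pos hx0 (-α)
  simp only [coefA, gridTau, Nat.add_sub_cancel, hmin]
  rw [integral_sub_rpow_neg_to_self hα1, sub_eq_add_neg 1 α, Real.rpow_add hx0, Real.rpow_one,
    ← sub_eq_add_neg]
  generalize (tTheta T r N (j + 1) θ - gridT T r N j) ^ (-α) = X at hxα ⊢
  rw [hx]
  calc X ≤ (1 - θ) * X / (1 - α) := by
        rw [le_div_iff₀ h1α]
        nlinarith
    _ = _ := by field_simp

theorem Gamma_mul_coefA_prev {T r θ α : ℝ} {N : ℕ} (hT : 0 < T) (hr : 1 ≤ r) (hN : 1 ≤ N)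
    (hθ : θ ≤ 1 / 2) (hα1 : α < 1) (j : ℕ) :
    Real.Gamma (1 - α) * coefA T r N (j + 2) θ α (j + 1)
      = (∫ s in gridT T r N j..gridT T r N (j + 1), (tTheta T r N (j + 2) θ - s) ^ (-α))
        / (gridT T r N (j + 1) - gridT T r N j) := by
  have hG : 0 < Real.Gamma (1 - α) := Real.Gamma_pos_of_pos (by linarith)
  have hb := sub_pos.2 (gridT_lt_succ hT hr hN j)
  simp only [coefA, gridTau, Nat.add_sub_cancel,
    min_eq_left (lt_tTheta hT hr hN hθ (j + 1)).le]
  field_simp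

theorem Gamma_mul_coefA_prev_le {T r θ α : ℝ} {N : ℕ} (hT : 0 < T) (hr : 1 ≤ r) (hN : 1 ≤ N)
    (hθ : θ ≤ 1 / 2) (hα0 : 0 ≤ α) (hα1 : α < 1) (j : ℕ) :
    Real.Gamma (1 - α) * coefA T r N (j + 2) θ α (j + 1)
      ≤ ((tTheta T r N (j + 2) θ - gridT T r N j) ^ (-α)
        + (tTheta T r N (j + 2) θ - gridT T r N (j + 1)) ^ (-α)) / 2 := by
  have hlt := gridT_lt_succ hT hr hN j
  rw [Gamma_mul_coefA_prev hT hr hN hθ hα1, div_le_iff₀ (sub_pos.2 hlt)]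
  have := integral_sub_rpow_neg_le_trapezoid hlt (lt_tTheta hT hr hN hθ (j + 1)) hα0
  linarith

theorem Gamma_mul_coefI_prev {T r θ α : ℝ} {N : ℕ} (hT : 0 < T) (hr : 1 ≤ r) (hN : 1 ≤ N)
    (hθ : θ ≤ 1 / 2) (hα1 : α < 1) (j : ℕ) :
    Real.Gamma (1 - α) * coefI T r N (j + 2) θ α (j + 1)
      = Real.Gamma (1 - α) * coefA T r N (j + 2) θ α (j + 1)
        - (tTheta T r N (j + 2) θ - gridT T r N j) ^ (-α) := by
  have hG : 0 < Real.Gamma (1 - α) := Real.Gamma_pos_of_pos (by linarith)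
  have hlt := gridT_lt_succ hT hr hN j
  have hb := sub_pos.2 hlt
  have hI := integral_sub_mul_sub_rpow α hlt.le (lt_tTheta hT hr hN hθ (j + 1))
  rw [Gamma_mul_coefA_prev hT hr hN hθ hα1]
  simp only [coefI, gridTau, Nat.add_sub_cancel]
  rw [div_mul_eq_mul_div, hI]
  field_simp

theorem Gamma_mul_gridRho_mul_coefB_le {T r θ α : ℝ} {N : ℕ} (hT : 0 < T) (hr : 1 ≤ r)
    (hN : 1 ≤ N) (hθ : θ ≤ 1 / 2) (hα0 : 0 ≤ α) (hα1 : α < 1) (j : ℕ) :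
    Real.Gamma (1 - α) * (gridRho T r N (j + 1) * coefB T r N (j + 3) θ α (j + 1))
      ≤ ((tTheta T r N (j + 3) θ - gridT T r N (j + 2)) ^ (-α)
        - (tTheta T r N (j + 3) θ - gridT T r N (j + 1)) ^ (-α)) / 4 := by
  have hG : 0 < Real.Gamma (1 - α) := Real.Gamma_pos_of_pos (by linarith)
  have h01 := gridT_lt_succ hT hr hN j
  have h12 : gridT T r N (j + 1) < gridT T r N (j + 2) := gridT_lt_succ hT hr hN (j + 1)
  have h2d : gridT T r N (j + 2) < tTheta T r N (j + 3) θ := lt_tTheta hT hr hN hθ (j + 2)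
  have hτ := gridTau_succ_le (N := N) hT hr j
  have hB := integral_sub_midpoint_mul_sub_rpow_le h01.le (h12.trans h2d) hα0
  have htan := rpow_neg_tangent_le (u := tTheta T r N (j + 3) θ - gridT T r N (j + 2))
    (y := tTheta T r N (j + 3) θ - gridT T r N (j + 1)) (by linarith) (by linarith) hα0
  simp only [gridRho, coefB, gridTau, Nat.add_sub_cancel, show j + 1 + 1 = j + 2 from rfl,
    show j + 2 - 1 = j + 1 from rfl]
  set d := tTheta T r N (j + 3) θ
  set M := α * (d - gridT T r N (j + 1)) ^ (-α - 1)
  have hM : 0 ≤ M := mul_nonneg hα0 (Real.rpow_nonneg (by linarith) _)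
  set c := gridT T r N (j + 1) - gridT T r N j
  set a := gridT T r N (j + 2) - gridT T r N (j + 1) with ha_def
  have hc : 0 < c := sub_pos.2 h01
  have ha : 0 < a := sub_pos.2 h12
  have hda : M * a ≤ (d - gridT T r N (j + 2)) ^ (-α) - (d - gridT T r N (j + 1)) ^ (-α) := by
    have : d - gridT T r N (j + 2) - (d - gridT T r N (j + 1)) = -a := by
      rw [ha_def]
      ring
    rw [this] at htan
    linarith
  set B := ∫ s in gridT T r N j..gridT T r N (j + 1),
    (s - (gridT T r N j + gridT T r N (j + 1)) / 2) * (d - s) ^ (-α)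
  have heq : Real.Gamma (1 - α) * (c / a * (2 / (c * (c + a) * Real.Gamma (1 - α)) * B))
      = 2 * B / (a * (c + a)) := by
    field_simp
  rw [heq]
  calc 2 * B / (a * (c + a)) ≤ M * a / 4 := by
        rw [div_le_iff₀ (by positivity)]
        have hc2 : c ^ 2 ≤ a ^ 2 := by gcongr
        have hc3 : c ^ 3 ≤ a ^ 2 * c := by nlinarith
        have ha3 : a ^ 2 * c ≤ a ^ 3 := by nlinarith [sq_nonneg a]
        have := mul_le_mul_of_nonneg_left
          (show 2 * c ^ 3 ≤ a ^ 2 * c + a ^ 3 by linarith) hM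
        linarith
    _ ≤ _ := by linarith

/-- For `2 ≤ n ≤ N`, `θ ∈ [0,1/2]`, `α ∈ (0,1)` with `α ≥ θ`:
if `n = 2` then `a_0^{(α)} - a_1^{(α)} ≥ I_1^{(α)}`; if `n ≥ 3` then
`a_0^{(α)} - a_1^{(α)} ≥ ρ_{n-2} b_2^{(α)} + (1/2) I_1^{(α)}`. -/
theorem coefA_zero_sub_one_lower (T r : ℝ) (N n : ℕ) (θ α : ℝ)
    (hT : 0 < T) (hr : 1 ≤ r) (hN : 1 ≤ N) (hn2 : 2 ≤ n) (hnN : n ≤ N)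
    (hθ0 : 0 ≤ θ) (hθ : θ ≤ 1 / 2) (hα0 : 0 < α) (hα1 : α < 1) (hθα : θ ≤ α) :
    (n = 2 →
      coefI T r N n θ α (n - 1) ≤ coefA T r N n θ α n - coefA T r N n θ α (n - 1)) ∧
    (3 ≤ n →
      gridRho T r N (n - 2) * coefB T r N n θ α (n - 2) + (1 / 2) * coefI T r N n θ α (n - 1)
        ≤ coefA T r N n θ α n - coefA T r N n θ α (n - 1)) := by
  have hG : 0 < Real.Gamma (1 - α) := Real.Gamma_pos_of_pos (by linarith)
  obtain ⟨j, rfl⟩ : ∃ j, n = j + 2 := ⟨n - 2, by omega⟩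
  have hA0 : (tTheta T r N (j + 2) θ - gridT T r N (j + 1)) ^ (-α)
      ≤ Real.Gamma (1 - α) * coefA T r N (j + 2) θ α (j + 2) :=
    rpow_neg_le_Gamma_mul_coefA_last hT hr hN hθ0 hθ hα1 hθα (j + 1)
  have hA1 := Gamma_mul_coefA_prev_le hT hr hN hθ hα0.le hα1 j
  have hI := Gamma_mul_coefI_prev hT hr hN hθ hα1 j
  rw [show j + 2 - 1 = j + 1 from rfl, Nat.add_sub_cancel]
  refine ⟨fun _ => le_of_mul_le_mul_left ?_ hG, fun h3 => le_of_mul_le_mul_left ?_ hG⟩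
  · linarith
  · obtain ⟨i, rfl⟩ : ∃ i, j = i + 1 := ⟨j - 1, by omega⟩
    have hB : Real.Gamma (1 - α) * (gridRho T r N (i + 1) * coefB T r N (i + 1 + 2) θ α (i + 1))
        ≤ ((tTheta T r N (i + 1 + 2) θ - gridT T r N (i + 1 + 1)) ^ (-α)
          - (tTheta T r N (i + 1 + 2) θ - gridT T r N (i + 1)) ^ (-α)) / 4 :=
      Gamma_mul_gridRho_mul_coefB_le hT hr hN hθ hα0.le hα1 i
    linarith
end
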